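/- Assume the family B satisfies positivity and that A_k ⊥⊥ G_k | B_k for every k = 0,…,p. Then for every k, π_{a_k}(G_k ∪ B_k) = π_{a_k}(B_k) a.s.; consequently the family (G,B) also satisfies positivity, λ_{ā_p}((G,B)̄_p) = λ_{ā_p}(B̄_p) a.s., and E[I_{ā_p}(Ā_p)·Y / λ_{ā_p}((G,B)̄_p)] = E[I_{ā_p}(Ā_p)·Y / λ_{ā_p}(B̄_p)]. (The 'sufficiency' part of Lemma 4.1: the inverse-probability-weighted functionals based on B and on (G,B) coincide.) -/

import Mathlib

open MeasureTheory ProbabilityTheory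

noncomputable section

/-- The σ-algebra generated by a set of real-valued random variables. -/
def genSig {Ω : Type*} (S : Set (Ω → ℝ)) : MeasurableSpace Ω :=
  ⨆ f ∈ S, MeasurableSpace.comap f (inferInstance : MeasurableSpace ℝ)

/-- Indicator `1_{A = a}` of the event that the random variable `A` takes the value `a`. -/
def ind {Ω : Type*} (A : Ω → ℝ) (a : ℝ) : Ω → ℝ := fun ω => if A ω = a then 1 else 0

/-- `I_{ā_{k-1}}(Ā_{k-1}) = ∏_{j<k} 1_{A_j = a_j}` (equal to `1` when `k = 0`). -/
def indUpto {Ω : Type*} (A : ℕ → Ω → ℝ) (a : ℕ → ℝ) (k : ℕ) : Ω → ℝ :=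
  fun ω => ∏ j ∈ Finset.range k, ind (A j) (a j) ω

variable {Ω : Type*} [MeasurableSpace Ω]

/-- Propensity `π_{a_k}(Z_k) = E[1_{A_k = a_k} ∣ σ(Z_k)]`. -/
def propen (μ : Measure Ω) (A : ℕ → Ω → ℝ) (a : ℕ → ℝ) (Z : ℕ → Set (Ω → ℝ)) (k : ℕ) : Ω → ℝ :=
  μ[ind (A k) (a k) | genSig (Z k)]

/-- Cumulative weight `λ_{ā_{k-1}}(Z̄_{k-1}) = ∏_{j<k} π_{a_j}(Z_j)` (equal to `1` when `k = 0`). -/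
def cumWeight (μ : Measure Ω) (A : ℕ → Ω → ℝ) (a : ℕ → ℝ) (Z : ℕ → Set (Ω → ℝ)) (k : ℕ) :
    Ω → ℝ :=
  fun ω => ∏ j ∈ Finset.range k, propen μ A a Z j ω

/-- The adjustment family `Z` satisfies positivity: the propensities are uniformly bounded away
from `0` almost surely, for every time `k = 0, …, p`. -/
def Positivity (μ : Measure Ω) (A : ℕ → Ω → ℝ) (a : ℕ → ℝ) (Z : ℕ → Set (Ω → ℝ)) (p : ℕ) :
    Prop :=
  ∃ c : ℝ, 0 < c ∧ ∀ k ≤ p, ∀ᵐ ω ∂μ, c ≤ propen μ A a Z k ω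

/-- Auxiliary downward recursion: `bAux μ A a Y Z p n` is the iterated regression
`b_{a_{p-n}}(Z)`. -/
def bAux (μ : Measure Ω) (A : ℕ → Ω → ℝ) (a : ℕ → ℝ) (Y : Ω → ℝ) (Z : ℕ → Set (Ω → ℝ))
    (p : ℕ) : ℕ → Ω → ℝ
  | 0 => fun ω =>
      (μ[fun ω' => Y ω' * ind (A p) (a p) ω' | genSig (Z p)]) ω / propen μ A a Z p ω
  | n + 1 => fun ω =>
      (μ[fun ω' => bAux μ A a Y Z p n ω' * ind (A (p - (n + 1))) (a (p - (n + 1))) ω' |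
          genSig (Z (p - (n + 1)))]) ω / propen μ A a Z (p - (n + 1)) ω

/-- Iterated regression `b_{a_k}(Z)`, for `k = 0, …, p`. -/
def breg (μ : Measure Ω) (A : ℕ → Ω → ℝ) (a : ℕ → ℝ) (Y : Ω → ℝ) (Z : ℕ → Set (Ω → ℝ))
    (p k : ℕ) : Ω → ℝ :=
  bAux μ A a Y Z p (p - k)

/-- `b_{a_{k-1}}(Z)` with the convention `b_{a_{-1}}(Z) = E[b_{a_0}(Z)]` (a constant). -/
def bregPrev (μ : Measure Ω) (A : ℕ → Ω → ℝ) (a : ℕ → ℝ) (Y : Ω → ℝ) (Z : ℕ → Set (Ω → ℝ))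
    (p k : ℕ) : Ω → ℝ :=
  if k = 0 then fun _ => ∫ ω, breg μ A a Y Z p 0 ω ∂μ else breg μ A a Y Z p (k - 1)

/-- The influence function `ψ_a(Z)`. -/
def psi (μ : Measure Ω) (A : ℕ → Ω → ℝ) (a : ℕ → ℝ) (Y : Ω → ℝ) (Z : ℕ → Set (Ω → ℝ))
    (p : ℕ) : Ω → ℝ := fun ω =>
  indUpto A a (p + 1) ω * (Y ω - breg μ A a Y Z p p ω) / cumWeight μ A a Z (p + 1) ω +
    ∑ k ∈ Finset.range (p + 1),
      indUpto A a k ω * (breg μ A a Y Z p k ω - bregPrev μ A a Y Z p k ω) /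
        cumWeight μ A a Z k ω

end

theorem MeasurableSpace.generateFrom_image2_inter {α : Type*} (m₁ m₂ : MeasurableSpace α) :
    MeasurableSpace.generateFrom
      (Set.image2 (· ∩ ·) {s | MeasurableSet[m₁] s} {t | MeasurableSet[m₂] t}) = m₁ ⊔ m₂ := by
  refine le_antisymm (MeasurableSpace.generateFrom_le ?_) (sup_le ?_ ?_)
  · rintro _ ⟨s, hs, t, ht, rfl⟩
    exact MeasurableSet.inter ((le_sup_left : m₁ ≤ m₁ ⊔ m₂) s hs)
      ((le_sup_right : m₂ ≤ m₁ ⊔ m₂) t ht)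
  · exact fun s hs => MeasurableSpace.measurableSet_generateFrom
      ⟨s, hs, Set.univ, MeasurableSet.univ, Set.inter_univ s⟩
  · exact fun t ht => MeasurableSpace.measurableSet_generateFrom
      ⟨Set.univ, MeasurableSet.univ, t, ht, Set.univ_inter t⟩

theorem isPiSystem_image2_inter {α : Type*} (m₁ m₂ : MeasurableSpace α) :
    IsPiSystem (Set.image2 (· ∩ ·) {s | MeasurableSet[m₁] s} {t | MeasurableSet[m₂] t}) := by
  rintro _ ⟨s, hs, t, ht, rfl⟩ _ ⟨s', hs', t', ht', rfl⟩ -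
  exact ⟨s ∩ s', MeasurableSet.inter hs hs', t ∩ t', MeasurableSet.inter ht ht',
    Set.inter_inter_inter_comm s s' t t'⟩

/-- The equality of set integrals characterising a conditional expectation extends from a
π-system generating the σ-algebra. -/
theorem setIntegral_eq_of_isPiSystem {α : Type*} {m mα : MeasurableSpace α} (hm : m ≤ mα)
    {μ : Measure α} {f g : α → ℝ} (hf : Integrable f μ) (hg : Integrable g μ)
    {C : Set (Set α)} (hC : m = MeasurableSpace.generateFrom C) (hpi : IsPiSystem C)
    (huniv : ∫ x, f x ∂μ = ∫ x, g x ∂μ)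
    (h : ∀ s ∈ C, ∫ x in s, f x ∂μ = ∫ x in s, g x ∂μ) {s : Set α} (hs : MeasurableSet[m] s) :
    ∫ x in s, f x ∂μ = ∫ x in s, g x ∂μ := by
  induction s, hs using MeasurableSpace.induction_on_inter hC hpi with
  | empty => simp
  | basic t ht => exact h t ht
  | compl t ht ih => rw [setIntegral_compl (hm t ht) hf, setIntegral_compl (hm t ht) hg, ih, huniv]
  | iUnion t hd ht ih =>
    rw [integral_iUnion (fun i => hm _ (ht i)) hd hf.integrableOn,
      integral_iUnion (fun i => hm _ (ht i)) hd hg.integrableOn]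
    simp_rw [ih]

/-- If `m₁` and `m₂` are conditionally independent given `m'`, then `m₂` carries no further
information on events of `m₁` once `m'` is known. -/
theorem ProbabilityTheory.CondIndep.condExp_indicator_sup {Ω : Type*}
    {m' m₁ m₂ mΩ : MeasurableSpace Ω} [StandardBorelSpace Ω] {μ : Measure Ω} [IsFiniteMeasure μ]
    {hm' : m' ≤ mΩ} (hm₁ : m₁ ≤ mΩ) (hm₂ : m₂ ≤ mΩ) (h : CondIndep m' m₁ m₂ hm' μ)
    {s : Set Ω} (hs : MeasurableSet[m₁] s) :
    μ⟦s | m₂ ⊔ m'⟧ =ᵐ[μ] μ⟦s | m'⟧ := by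
  have hint : ∀ {t : Set Ω}, MeasurableSet[mΩ] t → Integrable (t.indicator fun _ => (1 : ℝ)) μ :=
    fun ht => (integrable_const _).indicator ht
  have hsm := hm₁ s hs
  have hmeas : StronglyMeasurable[m₂ ⊔ m'] (μ⟦s | m'⟧) :=
    stronglyMeasurable_condExp.mono le_sup_right
  refine (ae_eq_condExp_of_forall_setIntegral_eq (sup_le hm₂ hm') (hint hsm)
    (fun _ _ _ => integrable_condExp.integrableOn) (fun t ht _ => ?_)
    hmeas.aestronglyMeasurable).symm
  refine setIntegral_eq_of_isPiSystem (sup_le hm₂ hm') integrable_condExp (hint hsm)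
    (MeasurableSpace.generateFrom_image2_inter m₂ m').symm (isPiSystem_image2_inter m₂ m')
    (integral_condExp hm') ?_ ht
  rintro _ ⟨u, hu, v, hv, rfl⟩
  have hum := hm₂ u hu
  have hmul : (u.indicator fun _ => (1 : ℝ)) * μ⟦s | m'⟧ = u.indicator (μ⟦s | m'⟧) := by
    ext ω
    by_cases hω : ω ∈ u <;> simp [hω]
  have hpull : μ[u.indicator (μ⟦s | m'⟧) | m'] =ᵐ[μ] μ⟦s ∩ u | m'⟧ := by
    have h₁ := condExp_mul_of_stronglyMeasurable_right (m := m') (μ := μ)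
      (f := u.indicator fun _ => (1 : ℝ)) (g := μ⟦s | m'⟧) stronglyMeasurable_condExp
      (hmul ▸ integrable_condExp.indicator hum) (hint hum)
    rw [hmul] at h₁
    filter_upwards [h₁, (condIndep_iff m' m₁ m₂ hm' hm₁ hm₂ μ).1 h s u hs hu] with ω h₁ h₂
    rw [h₁, h₂, Pi.mul_apply, Pi.mul_apply, mul_comm]
  calc ∫ ω in u ∩ v, (μ⟦s | m'⟧) ω ∂μ
      = ∫ ω in v, u.indicator (μ⟦s | m'⟧) ω ∂μ := by
        rw [setIntegral_indicator hum, Set.inter_comm]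
    _ = ∫ ω in v, (μ[u.indicator (μ⟦s | m'⟧) | m']) ω ∂μ :=
        (setIntegral_condExp hm' (integrable_condExp.indicator hum) hv).symm
    _ = ∫ ω in v, (μ⟦s ∩ u | m'⟧) ω ∂μ := integral_congr_ae (ae_restrict_of_ae hpull)
    _ = ∫ ω in v, (s ∩ u).indicator (fun _ => (1 : ℝ)) ω ∂μ :=
        setIntegral_condExp hm' (hint (hsm.inter hum)) hv
    _ = ∫ ω in u ∩ v, s.indicator (fun _ => (1 : ℝ)) ω ∂μ := by
        rw [Set.inter_comm s u, Set.inter_comm u v, ← Set.indicator_indicator,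
          setIntegral_indicator hum]

theorem genSig_union {Ω : Type*} (S T : Set (Ω → ℝ)) : genSig (S ∪ T) = genSig S ⊔ genSig T :=
  iSup_union

theorem ind_eq_indicator {Ω : Type*} (A : Ω → ℝ) (a : ℝ) :
    ind A a = (A ⁻¹' {a}).indicator fun _ => (1 : ℝ) := by
  ext ω
  by_cases h : A ω = a <;> simp [ind, h]

/-- sufficiency part of Lemma 4.1.  If `B` satisfies positivity and
`A_k ⊥⊥ G_k ∣ B_k` for every `k = 0, …, p`, then `π_(a_k)(G_k ∪ B_k) = π_(a_k)(B_k)` a.s. for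
every `k`; consequently `(G, B)` also satisfies positivity, the cumulative weights coincide a.s.,
and the inverse-probability-weighted functionals based on `B` and on `(G, B)` coincide. -/
theorem propen_union_eq_and_ipw_eq {Ω : Type*} [mΩ : MeasurableSpace Ω] [StandardBorelSpace Ω]
    (P : Measure Ω) [IsProbabilityMeasure P] (p : ℕ)
    (A : ℕ → Ω → ℝ) (hA : ∀ k, Measurable (A k))
    (hAfin : ∀ k, (Set.range (A k)).Finite)
    (Y : Ω → ℝ) (hYm : Measurable Y) (hYbd : ∃ C : ℝ, ∀ ω, |Y ω| ≤ C)
    (a : ℕ → ℝ) (ha : ∀ k ≤ p, a k ∈ Set.range (A k))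
    (G B : ℕ → Set (Ω → ℝ))
    (hGle : ∀ k, genSig (G k) ≤ mΩ) (hBle : ∀ k, genSig (B k) ≤ mΩ)
    (hBpos : Positivity P A a B p)
    (hCI : ∀ k ≤ p,
      CondIndep (genSig (B k)) (MeasurableSpace.comap (A k) inferInstance) (genSig (G k))
        (hBle k) P) :
    (∀ k ≤ p, propen P A a (fun i => G i ∪ B i) k =ᵐ[P] propen P A a B k) ∧
    Positivity P A a (fun i => G i ∪ B i) p ∧
    cumWeight P A a (fun i => G i ∪ B i) (p + 1) =ᵐ[P] cumWeight P A a B (p + 1) ∧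
    ∫ ω, indUpto A a (p + 1) ω * Y ω / cumWeight P A a (fun i => G i ∪ B i) (p + 1) ω ∂P =
      ∫ ω, indUpto A a (p + 1) ω * Y ω / cumWeight P A a B (p + 1) ω ∂P := by
  have hpropen : ∀ k ≤ p, propen P A a (fun i => G i ∪ B i) k =ᵐ[P] propen P A a B k := by
    intro k hk
    unfold propen
    rw [genSig_union, ind_eq_indicator]
    exact (hCI k hk).condExp_indicator_sup (hA k).comap_le (hGle k)
      ⟨{a k}, measurableSet_singleton _, rfl⟩
  have hweight : cumWeight P A a (fun i => G i ∪ B i) (p + 1) =ᵐ[P] cumWeight P A a B (p + 1) := by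
    have hall := (Finset.eventually_all (Finset.range (p + 1))).2
      fun k hk => hpropen k (Nat.lt_succ_iff.1 (Finset.mem_range.1 hk))
    filter_upwards [hall] with ω hω
    exact Finset.prod_congr rfl hω
  refine ⟨hpropen, ?_, hweight, ?_⟩
  · obtain ⟨c, hc, hB⟩ := hBpos
    refine ⟨c, hc, fun k hk => ?_⟩
    filter_upwards [hB k hk, hpropen k hk] with ω h₁ h₂
    rwa [h₂]
  · refine integral_congr_ae ?_
    filter_upwards [hweight] with ω hω
    rw [hω]
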